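/- Given Petz data (V, X, Y, V_N, M, K, X_P, Y_P), the Gaussian Petz channel matrices satisfy the complete-positivity condition: the Hermitian complex 2n×2n matrix Y_P + iΩ_n − i X_P Ω_m X_Pᵀ is positive semidefinite. -/

import Mathlib

noncomputable section
open Matrix
open scoped ComplexOrder

/-- The standard `2n × 2n` symplectic form matrix `Ω = [[0, I], [-I, 0]]`. -/
def Om (n : ℕ) : Matrix (Fin n ⊕ Fin n) (Fin n ⊕ Fin n) ℝ :=
  Matrix.fromBlocks 0 1 (-1) 0

/-- Complexification of a real matrix. -/
def cm {k l : Type*} (A : Matrix k l ℝ) : Matrix k l ℂ := A.map Complex.ofReal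

section Complexification

variable {k l p : Type*}

lemma cm_mul [Fintype l] (A : Matrix k l ℝ) (B : Matrix l p ℝ) : cm (A * B) = cm A * cm B :=
  Matrix.map_mul (f := Complex.ofRealHom)

lemma cm_add (A B : Matrix k l ℝ) : cm (A + B) = cm A + cm B := by
  ext; simp [cm]

lemma cm_sub (A B : Matrix k l ℝ) : cm (A - B) = cm A - cm B := by
  ext; simp [cm]

lemma cm_neg (A : Matrix k l ℝ) : cm (-A) = -cm A := by
  ext; simp [cm]

lemma cm_transpose (A : Matrix k l ℝ) : cm Aᵀ = (cm A)ᵀ := rfl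

lemma cm_conjTranspose (A : Matrix k l ℝ) : (cm A)ᴴ = (cm A)ᵀ := by
  ext; simp [cm]

lemma cm_one [DecidableEq k] : cm (1 : Matrix k k ℝ) = 1 := by
  exact Matrix.map_one _ Complex.ofReal_zero Complex.ofReal_one

lemma cm_inv [Fintype k] [DecidableEq k] {A : Matrix k k ℝ} (hA : IsUnit A) :
    cm A⁻¹ = (cm A)⁻¹ := by
  refine (Matrix.inv_eq_left_inv ?_).symm
  rw [← cm_mul, Matrix.nonsing_inv_mul _ ((Matrix.isUnit_iff_isUnit_det _).1 hA), cm_one]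

lemma isUnit_of_isUnit_cm [Fintype k] [DecidableEq k] {A : Matrix k k ℝ}
    (hA : IsUnit (cm A)) : IsUnit A := by
  rw [Matrix.isUnit_iff_isUnit_det, isUnit_iff_ne_zero] at hA ⊢
  intro h
  apply hA
  have := Complex.ofRealHom.map_det A
  rw [h, map_zero] at this
  exact this.symm

lemma cm_charpoly [Fintype k] [DecidableEq k] (A : Matrix k k ℝ) :
    (cm A).charpoly = A.charpoly.map (algebraMap ℝ ℂ) :=
  Matrix.charpoly_map A (algebraMap ℝ ℂ)

end Complexification

section SquareRoot

variable {ι : Type*} [Fintype ι] [DecidableEq ι]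

open Polynomial

/-- The homogeneous Sylvester equation `A Z = Z B` has only the zero solution if `A` and `B`
are annihilated by coprime polynomials. -/
lemma eq_zero_of_mul_eq_mul_of_isCoprime {A B Z : Matrix ι ι ℝ} {p q : ℝ[X]}
    (hpq : IsCoprime p q) (hA : aeval A p = 0) (hB : aeval B q = 0) (h : A * Z = Z * B) :
    Z = 0 := by
  have hr (r : ℝ[X]) : aeval A r * Z = Z * aeval B r := by
    induction r using Polynomial.induction_on' with
    | add r s hr hs => simp only [map_add, add_mul, mul_add, hr, hs]
    | monomial n a =>
      have hn : A ^ n * Z = Z * B ^ n := by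
        have hZ : SemiconjBy Z B A := h.symm
        exact (hZ.pow_right n).eq.symm
      simp only [aeval_monomial, ← Algebra.smul_def, smul_mul_assoc, mul_smul_comm, hn]
  obtain ⟨a, b, hab⟩ := hpq
  have h1 : aeval B (a * p) = 1 := by
    have := congrArg (aeval B) hab
    simpa [hB] using this
  calc Z = Z * aeval B (a * p) := by rw [h1, mul_one]
    _ = aeval A (a * p) * Z := (hr _).symm
    _ = 0 := by simp [hA]

lemma isCoprime_charpoly_comp_neg {M : Matrix ι ι ℝ}
    (hM : ∀ μ : ℂ, (cm M).charpoly.IsRoot μ → μ.im = 0 ∧ 0 < μ.re) :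
    IsCoprime M.charpoly (M.charpoly.comp (-X)) := by
  rw [Polynomial.isCoprime_iff_aeval_ne_zero_of_isAlgClosed ℝ ℂ]
  intro a
  by_contra! h
  have hroot {z : ℂ} (hz : aeval z M.charpoly = 0) : 0 < z.re := by
    refine (hM z ?_).2
    rwa [cm_charpoly, IsRoot, eval_map_algebraMap]
  have h1 := hroot h.1
  have h2 : 0 < (-a).re := hroot (by simpa [aeval_comp] using h.2)
  simp only [Complex.neg_re] at h2
  linarith

/-- A real matrix whose complex eigenvalues are positive is determined by its square together
with its characteristic polynomial. -/
lemma eq_of_mul_self_eq_of_charpoly_eq {M N : Matrix ι ι ℝ}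
    (hM : ∀ μ : ℂ, (cm M).charpoly.IsRoot μ → μ.im = 0 ∧ 0 < μ.re)
    (hNM : N.charpoly = M.charpoly) (h : M * M = N * N) : M = N := by
  refine sub_eq_zero.1 (eq_zero_of_mul_eq_mul_of_isCoprime (A := M) (B := -N)
    (isCoprime_charpoly_comp_neg hM) (Matrix.aeval_self_charpoly M) ?_ ?_)
  · rw [← hNM, aeval_comp]
    simp [Matrix.aeval_self_charpoly]
  · rw [mul_sub, h]
    noncomm_ring

lemma isUnit_of_pos_eigenvalues {M : Matrix ι ι ℝ}
    (hM : ∀ μ : ℂ, (cm M).charpoly.IsRoot μ → μ.im = 0 ∧ 0 < μ.re) : IsUnit M := by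
  apply isUnit_of_isUnit_cm
  rw [Matrix.isUnit_iff_isUnit_det, isUnit_iff_ne_zero]
  intro h
  have := (hM 0 (by
    rw [IsRoot, Matrix.eval_charpoly]
    simp [Matrix.det_neg, h])).2
  simp at this

end SquareRoot

section Covariance

lemma posDef_conj {ι : Type*} {V J : Matrix ι ι ℝ} (hV : V.IsSymm) (hJ : Jᵀ = -J)
    (h : (cm V + Complex.I • cm J).PosDef) : (cm V - Complex.I • cm J).PosDef := by
  have := h.transpose
  rwa [Matrix.transpose_add, Matrix.transpose_smul, ← cm_transpose, ← cm_transpose, hV.eq, hJ,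
    cm_neg, smul_neg, ← sub_eq_add_neg] at this

variable {ι : Type*} [Fintype ι] [DecidableEq ι]

lemma isUnit_of_posDef {V J : Matrix ι ι ℝ} (hV : V.IsSymm) (hJ : Jᵀ = -J)
    (h : (cm V + Complex.I • cm J).PosDef) : IsUnit V := by
  apply isUnit_of_isUnit_cm
  have h2 : ((2 : ℂ) • cm V).PosDef := by
    convert h.add (posDef_conj hV hJ h) using 1
    rw [two_smul]; abel
  have h3 : (2⁻¹ : ℂ) • (2 : ℂ) • cm V = cm V := by simp [smul_smul]
  have := h2.isUnit
  rw [← h3]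
  exact this.smul (Units.mk0 (2⁻¹ : ℂ) (by norm_num))

lemma inv_mul_symplectic {V J : Matrix ι ι ℝ} (hJ2 : J * J = -1) :
    (V * J)⁻¹ = -(J * V⁻¹) := by
  rw [Matrix.mul_inv_rev, Matrix.inv_eq_left_inv (B := -J) (by rw [neg_mul, hJ2, neg_neg]),
    neg_mul]

/-- The positive square root `M` of `1 + (V J)⁻²` satisfies `M V = V Mᵀ`. -/
lemma sqrt_mul_comm {V J M : Matrix ι ι ℝ} (hV : V.IsSymm) (hVu : IsUnit V) (hJ : Jᵀ = -J)
    (hJ2 : J * J = -1) (hM2 : M * M = 1 + ((V * J)⁻¹) ^ 2)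
    (hM : ∀ μ : ℂ, (cm M).charpoly.IsRoot μ → μ.im = 0 ∧ 0 < μ.re) :
    M * V = V * Mᵀ := by
  have hdet := (Matrix.isUnit_iff_isUnit_det _).1 hVu
  have h1 : V⁻¹ * V = 1 := Matrix.nonsing_inv_mul _ hdet
  have h2 : V * V⁻¹ = 1 := Matrix.mul_nonsing_inv _ hdet
  have hVi : V⁻¹ᵀ = V⁻¹ := by rw [Matrix.transpose_nonsing_inv, hV.eq]
  rw [inv_mul_symplectic hJ2, neg_sq, sq] at hM2
  have hMt : Mᵀ * Mᵀ = 1 + V⁻¹ * J * (V⁻¹ * J) := by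
    rw [← Matrix.transpose_mul, hM2]
    simp [Matrix.transpose_mul, hJ, hVi]
  have key : M = V * Mᵀ * V⁻¹ := by
    refine eq_of_mul_self_eq_of_charpoly_eq hM ?_ ?_
    · have := Matrix.charpoly_units_conj hVu.unit Mᵀ
      rw [Matrix.charpoly_transpose] at this
      exact this
    · calc M * M = V * (Mᵀ * Mᵀ) * V⁻¹ := by
            rw [hM2, hMt, mul_add, add_mul, mul_one, h2]
            simp only [← mul_assoc, h2, one_mul]
        _ = V * Mᵀ * (V⁻¹ * V) * Mᵀ * V⁻¹ := by rw [h1]; noncomm_ring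
        _ = V * Mᵀ * V⁻¹ * (V * Mᵀ * V⁻¹) := by noncomm_ring
  calc M * V = V * Mᵀ * V⁻¹ * V := by rw [← key]
    _ = V * Mᵀ := by rw [mul_assoc, h1, mul_one]

/-- The positive square root `M` of `1 + (V J)⁻²` intertwines `V + iJ` with the inverse of its
complex conjugate. -/
lemma sqrt_mul_inv_conj_mul {V J M : Matrix ι ι ℝ} (hV : V.IsSymm) (hJ : Jᵀ = -J)
    (hJ2 : J * J = -1) (hpd : (cm V + Complex.I • cm J).PosDef)
    (hM2 : M * M = 1 + ((V * J)⁻¹) ^ 2) (hMc : M * (V * J) = V * J * M)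
    (hM : ∀ μ : ℂ, (cm M).charpoly.IsRoot μ → μ.im = 0 ∧ 0 < μ.re) :
    cm (M * V) * (cm V - Complex.I • cm J)⁻¹ * (cm (M * V))ᵀ = cm V + Complex.I • cm J := by
  have hVu := isUnit_of_posDef hV hJ hpd
  have hdet := (Matrix.isUnit_iff_isUnit_det _).1 hVu
  have hMV := sqrt_mul_comm hV hVu hJ hJ2 hM2 hM
  have hBdet := (Matrix.isUnit_iff_isUnit_det _).1 (posDef_conj hV hJ hpd).isUnit
  have hVi : cm V⁻¹ * cm V = 1 := by rw [← cm_mul, Matrix.nonsing_inv_mul _ hdet, cm_one]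
  have hVi' : cm V * cm V⁻¹ = 1 := by rw [← cm_mul, Matrix.mul_nonsing_inv _ hdet, cm_one]
  have hc : J * V⁻¹ * (V * J) = -1 := by
    rw [mul_assoc, ← mul_assoc V⁻¹, Matrix.nonsing_inv_mul _ hdet, one_mul, hJ2]
  have hc' : V * J * (J * V⁻¹) = -1 := by
    rw [mul_assoc, ← mul_assoc J, hJ2, neg_mul, one_mul, mul_neg, Matrix.mul_nonsing_inv _ hdet]
  have hMcomm : M * (J * V⁻¹) = J * V⁻¹ * M := by
    have : J * V⁻¹ * (M * (V * J)) * (J * V⁻¹) = J * V⁻¹ * (V * J * M) * (J * V⁻¹) := by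
      rw [hMc]
    rw [← mul_assoc (J * V⁻¹) (V * J), hc, ← mul_assoc (J * V⁻¹) M, mul_assoc _ (V * J),
      hc'] at this
    simpa using this.symm
  rw [inv_mul_symplectic hJ2, neg_sq, sq] at hM2
  have hcM : cm M * cm (J * V⁻¹) = cm (J * V⁻¹) * cm M := by rw [← cm_mul, hMcomm, cm_mul]
  have hcM2 : cm M * cm M = 1 + cm (J * V⁻¹) * cm (J * V⁻¹) := by
    rw [← cm_mul, hM2, cm_add, cm_one, cm_mul]
  have hcV : cm (J * V⁻¹) * cm V = cm J := by rw [cm_mul, mul_assoc, hVi, mul_one]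
  have htr : (cm (M * V))ᵀ = cm M * cm V := by
    rw [← cm_transpose, Matrix.transpose_mul, hV.eq, ← hMV, cm_mul]
  rw [htr, cm_mul]
  have hfac : cm V - Complex.I • cm J = (1 - Complex.I • cm (J * V⁻¹)) * cm V := by
    rw [sub_mul, one_mul, smul_mul_assoc, hcV]
  have hfac' : cm V + Complex.I • cm J = (1 + Complex.I • cm (J * V⁻¹)) * cm V := by
    rw [add_mul, one_mul, smul_mul_assoc, hcV]
  have hT1 := Matrix.mul_nonsing_inv _ hBdet
  have hT2 := Matrix.nonsing_inv_mul _ hBdet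
  rw [hfac']
  rw [hfac] at hT1 hT2 ⊢
  generalize ((1 - Complex.I • cm (J * V⁻¹)) * cm V)⁻¹ = B at *
  generalize cm (J * V⁻¹) = c at *
  set D := 1 - Complex.I • c with hD
  have hDT : D * (cm V * B) = 1 := by rw [← mul_assoc, hT1]
  have hTD : cm V * B * D = 1 := by
    calc cm V * B * D = cm V * (B * (D * cm V)) * cm V⁻¹ := by
          simp only [mul_assoc, hVi', mul_one]
      _ = 1 := by rw [hT2, mul_one, hVi']
  have hMD : cm M * D = D * cm M := by
    rw [hD, mul_sub, sub_mul, mul_smul_comm, smul_mul_assoc, hcM, one_mul, mul_one]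
  have hsq : cm M * cm M = (1 + Complex.I • c) * D := by
    simp only [hcM2, hD, add_mul, mul_sub, mul_smul_comm, smul_mul_assoc, smul_add, smul_smul,
      Complex.I_mul_I, neg_smul, one_smul, one_mul, mul_one]
    abel
  have hTM : cm V * B * cm M = cm M * (cm V * B) := by
    calc cm V * B * cm M = cm V * B * (cm M * D) * (cm V * B) := by
          rw [mul_assoc _ _ (cm V * B), mul_assoc _ D, hDT, mul_one]
      _ = cm V * B * D * cm M * (cm V * B) := by rw [hMD, ← mul_assoc _ D]
      _ = cm M * (cm V * B) := by rw [hTD, one_mul]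
  calc cm M * cm V * B * (cm M * cm V) = cm M * (cm V * B * cm M) * cm V := by
        simp only [mul_assoc]
    _ = cm M * cm M * (cm V * B) * cm V := by rw [hTM]; simp only [mul_assoc]
    _ = (1 + Complex.I • c) * cm V := by rw [hsq, mul_assoc _ D, hDT, mul_one]

end Covariance

lemma Om_transpose (n : ℕ) : (Om n)ᵀ = -Om n := by
  simp [Om, Matrix.fromBlocks_transpose, Matrix.fromBlocks_neg]

lemma Om_mul_self (n : ℕ) : Om n * Om n = -1 := by
  simp only [Om, Matrix.fromBlocks_multiply]
  rw [← Matrix.fromBlocks_one, Matrix.fromBlocks_neg]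
  simp

/-- For positive definite `A` and `B`, the bound `X A Xᴴ ≤ B` implies `Xᴴ B⁻¹ X ≤ A⁻¹`. -/
lemma posSemidef_inv_sub_of_posSemidef_sub {ι κ : Type*} [Fintype ι] [DecidableEq ι] [Fintype κ]
    [DecidableEq κ] {A : Matrix ι ι ℂ} {B : Matrix κ κ ℂ} {X : Matrix κ ι ℂ} (hA : A.PosDef)
    (hB : B.PosDef) (h : (B - X * A * Xᴴ).PosSemidef) : (A⁻¹ - Xᴴ * B⁻¹ * X).PosSemidef := by
  let _ := hA.inv.isUnit.invertible
  let _ := hB.isUnit.invertible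
  have h1 := Matrix.PosDef.fromBlocks₁₁ Xᴴ B hA.inv
  have h2 := Matrix.PosDef.fromBlocks₂₂ A⁻¹ Xᴴ hB
  rw [Matrix.conjTranspose_conjTranspose,
    Matrix.nonsing_inv_nonsing_inv _ ((Matrix.isUnit_iff_isUnit_det _).1 hA.isUnit)] at h1
  rw [Matrix.conjTranspose_conjTranspose] at h2
  exact h2.1 (h1.2 h)

lemma vecMul_cm_injective {ι κ : Type*} [Fintype ι] [DecidableEq ι] [Fintype κ] [DecidableEq κ]
    {X : Matrix κ ι ℝ} (hX : X.rank = Fintype.card κ) :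
    Function.Injective fun v => v ᵥ* cm X := by
  have hu : IsUnit (X * Xᵀ) := by
    rw [← Matrix.rank_self_mul_transpose] at hX
    rw [← Matrix.linearIndependent_rows_iff_isUnit, linearIndependent_iff_card_eq_finrank_span,
      ← hX, Matrix.rank_eq_finrank_span_row]
    rfl
  have h1 : cm X * cm (Xᵀ * (X * Xᵀ)⁻¹) = 1 := by
    rw [← cm_mul, ← Matrix.mul_assoc,
      Matrix.mul_nonsing_inv _ ((Matrix.isUnit_iff_isUnit_det _).1 hu), cm_one]
  refine Function.LeftInverse.injective (g := fun v => v ᵥ* cm (Xᵀ * (X * Xᵀ)⁻¹)) fun v => ?_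
  simp [Matrix.vecMul_vecMul, h1]

/-- Given Petz data `(V, X, Y, V_N, M, K, X_P, Y_P)`, the Gaussian Petz channel matrices
satisfy the complete-positivity condition: `Y_P + iΩ_n - i X_P Ω_m X_Pᵀ ⪰ 0`. -/
theorem petz_channel_complete_positivity (n m : ℕ) (hmn : m ≤ n)
    (V M : Matrix (Fin n ⊕ Fin n) (Fin n ⊕ Fin n) ℝ)
    (X : Matrix (Fin m ⊕ Fin m) (Fin n ⊕ Fin n) ℝ)
    (Y VN K : Matrix (Fin m ⊕ Fin m) (Fin m ⊕ Fin m) ℝ)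
    (XP : Matrix (Fin n ⊕ Fin n) (Fin m ⊕ Fin m) ℝ)
    (YP : Matrix (Fin n ⊕ Fin n) (Fin n ⊕ Fin n) ℝ)
    (hV : V.IsSymm)
    (hVpd : (cm V + Complex.I • cm (Om n)).PosDef)
    (hXrank : X.rank = 2 * m)
    (hY : Y.IsSymm)
    (hYcp : (cm Y + Complex.I • cm (Om m)
        - Complex.I • (cm X * cm (Om n) * (cm X)ᵀ)).PosSemidef)
    (hVN : VN = X * V * Xᵀ + Y)
    (hM2 : M * M = 1 + ((V * Om n)⁻¹) ^ 2)
    (hMcomm : M * (V * Om n) = (V * Om n) * M)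
    (hMeig : ∀ μ : ℂ, (cm M).charpoly.IsRoot μ → μ.im = 0 ∧ 0 < μ.re)
    (hK2 : K * K = 1 + ((Om m * VN)⁻¹) ^ 2)
    (hKcomm : K * (Om m * VN) = (Om m * VN) * K)
    (hKeig : ∀ μ : ℂ, (cm K).charpoly.IsRoot μ → μ.im = 0 ∧ 0 < μ.re)
    (hXP : XP = M * V * Xᵀ * K⁻¹ * VN⁻¹)
    (hYP : YP = V - XP * VN * XPᵀ) :
    (cm YP + Complex.I • cm (Om n)
      - Complex.I • (cm XP * cm (Om m) * (cm XP)ᵀ)).PosSemidef := by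
  have hJn := Om_transpose n
  have hJm := Om_transpose m
  have hA := posDef_conj hV hJn hVpd
  have hXinj := vecMul_cm_injective (X := X) (by simpa [two_mul] using hXrank)
  have hVNs : VN.IsSymm := by
    rw [Matrix.IsSymm, hVN]
    simp [Matrix.transpose_mul, hV.eq, hY.eq, Matrix.mul_assoc]
  have hcVN : cm VN = cm X * cm V * (cm X)ᵀ + cm Y := by
    rw [hVN, cm_add, cm_mul, cm_mul, cm_transpose]
  have hB' : (cm VN + Complex.I • cm (Om m)).PosDef := by
    have h := (hVpd.mul_mul_conjTranspose_same hXinj).add_posSemidef hYcp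
    convert h using 1
    rw [cm_conjTranspose, hcVN, Matrix.mul_add, Matrix.add_mul, Matrix.mul_smul, Matrix.smul_mul]
    abel
  have hB := posDef_conj hVNs hJm hB'
  have hle : (cm VN - Complex.I • cm (Om m)
      - cm X * (cm V - Complex.I • cm (Om n)) * (cm X)ᴴ).PosSemidef := by
    refine (congrArg Matrix.PosSemidef ?_).mpr hYcp.transpose
    rw [cm_conjTranspose, hcVN, Matrix.mul_sub, Matrix.sub_mul, Matrix.mul_smul, Matrix.smul_mul]
    simp only [Matrix.transpose_sub, Matrix.transpose_add, Matrix.transpose_smul,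
      Matrix.transpose_mul, Matrix.transpose_transpose]
    simp only [← cm_transpose, hY.eq, hJm, hJn, cm_neg, Matrix.mul_neg, Matrix.neg_mul, smul_neg,
      Matrix.mul_assoc]
    abel
  have hS := posSemidef_inv_sub_of_posSemidef_sub hA hB hle
  have hVNu := isUnit_of_posDef hVNs hJm hB'
  have hKu := isUnit_of_pos_eigenvalues hKeig
  have hLt : (Om m * VN)ᵀ = -(VN * Om m) := by
    rw [Matrix.transpose_mul, hVNs.eq, hJm, Matrix.mul_neg]
  have hKt2 : Kᵀ * Kᵀ = 1 + ((VN * Om m)⁻¹) ^ 2 := by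
    rw [← Matrix.transpose_mul, hK2, Matrix.transpose_add, Matrix.transpose_pow,
      Matrix.transpose_nonsing_inv, hLt, Matrix.transpose_one, ← Matrix.mul_neg, Matrix.mul_inv_rev,
      Matrix.inv_eq_left_inv (B := Om m) (by rw [Matrix.mul_neg, Om_mul_self, neg_neg]),
      inv_mul_symplectic (Om_mul_self m), neg_sq]
  have hKtc : Kᵀ * (VN * Om m) = VN * Om m * Kᵀ := by
    have h := congrArg Matrix.transpose hKcomm
    rw [Matrix.transpose_mul, Matrix.transpose_mul (Om m * VN) K, hLt] at h
    simpa using h.symm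
  have hKteig : ∀ μ : ℂ, (cm Kᵀ).charpoly.IsRoot μ → μ.im = 0 ∧ 0 < μ.re := by
    intro μ hμ
    rw [cm_transpose, Matrix.charpoly_transpose] at hμ
    exact hKeig μ hμ
  have hAid := sqrt_mul_inv_conj_mul hV hJn (Om_mul_self n) hVpd hM2 hMcomm hMeig
  have hBid := sqrt_mul_inv_conj_mul hVNs hJm (Om_mul_self m) hB' hKt2 hKtc hKteig
  have hKV := sqrt_mul_comm hVNs hVNu hJm (Om_mul_self m) hKt2 hKteig
  rw [Matrix.transpose_transpose] at hKV
  have hP : XP * (Kᵀ * VN) = M * V * Xᵀ := by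
    rw [hXP, hKV, Matrix.mul_assoc (M * V * Xᵀ * K⁻¹), ← Matrix.mul_assoc VN⁻¹,
      Matrix.nonsing_inv_mul _ ((Matrix.isUnit_iff_isUnit_det _).1 hVNu), Matrix.one_mul,
      Matrix.mul_assoc,
      Matrix.nonsing_inv_mul _ ((Matrix.isUnit_iff_isUnit_det _).1 hKu), Matrix.mul_one]
  have hcP : cm XP * cm (Kᵀ * VN) = cm (M * V) * (cm X)ᵀ := by
    rw [← cm_mul, hP, cm_mul, cm_transpose]
  have hXB : cm XP * (cm VN + Complex.I • cm (Om m)) * (cm XP)ᵀ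
      = cm (M * V) * ((cm X)ᴴ * (cm VN - Complex.I • cm (Om m))⁻¹ * cm X) * (cm (M * V))ᵀ := by
    rw [← hBid, cm_conjTranspose]
    calc _ = (cm XP * cm (Kᵀ * VN)) * (cm VN - Complex.I • cm (Om m))⁻¹
          * (cm XP * cm (Kᵀ * VN))ᵀ := by
          simp only [Matrix.transpose_mul, Matrix.mul_assoc]
      _ = _ := by
          rw [hcP]
          simp only [Matrix.transpose_mul, Matrix.transpose_transpose, Matrix.mul_assoc]
  have hfin := hS.mul_mul_conjTranspose_same (cm (M * V))
  convert hfin using 1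
  rw [cm_conjTranspose (M * V), Matrix.mul_sub, Matrix.sub_mul, hAid, ← hXB, hYP, cm_sub, cm_mul,
    cm_mul, cm_transpose, Matrix.mul_add, Matrix.add_mul, Matrix.mul_smul, Matrix.smul_mul]
  abel
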